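/- arXiv:2405.03260 — 3 statements merged into one kernel-verified Lean document; each statement's English description precedes it below -/
import Mathlib

section
/- Suppose U and V satisfy the (3,4) string equation (S1),(S2) and the KP flow equations (F1)–(F4) at every point of ℝ³. Then the Darboux coordinates of (U,V) satisfy Hamilton's equations in the variable t₂ with Hamiltonian H₂: for every a ∈ {U,V,W} and every (t₅,t₂,x) ∈ ℝ³, ∂Q_a/∂t₂ = ∂H₂/∂P_a and ∂P_a/∂t₂ = −∂H₂/∂Q_a, where the partial derivatives of the polynomial H₂ are evaluated at (Q_U(t₅,t₂,x), Q_V(t₅,t₂,x), Q_W(t₅,t₂,x), P_U(t₅,t₂,x), P_V(t₅,t₂,x), P_W(t₅,t₂,x), x, t₂, t₅). -/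
noncomputable def Ham2 {K : Type*} [Field K] (qU qV qW pU pV pW t1 t2 t5 : K) : K :=
  (1/2) * pV * qU * qW + (1/4) * qV * qW ^ 2 - 2 * pU * pV - 6 * pW * qU * qV
    + qV ^ 3 + qU ^ 3 * qV + 2 * t1 * qV
    + t2 * (4 * pW - qU ^ 2)
    + (1/2) * t5 * (qV * qU ^ 2 - pV * qW + 4 * qV * pW)
    - 2 * t5 * t2 * qU - (65/27) * t5 ^ 3 * qV - (22/9) * t5 ^ 2 * t2

noncomputable def DqU (H : ℝ → ℝ → ℝ → ℝ → ℝ → ℝ → ℝ → ℝ → ℝ → ℝ)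
    (qU qV qW pU pV pW t1 t2 t5 : ℝ) : ℝ :=
  deriv (fun s => H s qV qW pU pV pW t1 t2 t5) qU

noncomputable def DqV (H : ℝ → ℝ → ℝ → ℝ → ℝ → ℝ → ℝ → ℝ → ℝ → ℝ)
    (qU qV qW pU pV pW t1 t2 t5 : ℝ) : ℝ :=
  deriv (fun s => H qU s qW pU pV pW t1 t2 t5) qV

noncomputable def DqW (H : ℝ → ℝ → ℝ → ℝ → ℝ → ℝ → ℝ → ℝ → ℝ → ℝ)
    (qU qV qW pU pV pW t1 t2 t5 : ℝ) : ℝ :=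
  deriv (fun s => H qU qV s pU pV pW t1 t2 t5) qW

noncomputable def DpU (H : ℝ → ℝ → ℝ → ℝ → ℝ → ℝ → ℝ → ℝ → ℝ → ℝ)
    (qU qV qW pU pV pW t1 t2 t5 : ℝ) : ℝ :=
  deriv (fun s => H qU qV qW s pV pW t1 t2 t5) pU

noncomputable def DpV (H : ℝ → ℝ → ℝ → ℝ → ℝ → ℝ → ℝ → ℝ → ℝ → ℝ)
    (qU qV qW pU pV pW t1 t2 t5 : ℝ) : ℝ :=
  deriv (fun s => H qU qV qW pU s pW t1 t2 t5) pV

noncomputable def DpW (H : ℝ → ℝ → ℝ → ℝ → ℝ → ℝ → ℝ → ℝ → ℝ → ℝ)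
    (qU qV qW pU pV pW t1 t2 t5 : ℝ) : ℝ :=
  deriv (fun s => H qU qV qW pU pV s t1 t2 t5) pW

noncomputable def QUc (U : ℝ → ℝ → ℝ → ℝ) (t5 t2 x : ℝ) : ℝ :=
  U t5 t2 x - (4/3) * t5

noncomputable def QVc (V : ℝ → ℝ → ℝ → ℝ) (t5 t2 x : ℝ) : ℝ :=
  V t5 t2 x

noncomputable def QWc (U : ℝ → ℝ → ℝ → ℝ) (t5 t2 x : ℝ) : ℝ :=
  deriv (U t5 t2) x

noncomputable def PUc (U : ℝ → ℝ → ℝ → ℝ) (t5 t2 x : ℝ) : ℝ :=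
  (1/4) * (3 * U t5 t2 x * deriv (U t5 t2) x - (1/3) * deriv^[3] (U t5 t2) x
    - (7/3) * t5 * deriv (U t5 t2) x)

noncomputable def PVc (V : ℝ → ℝ → ℝ → ℝ) (t5 t2 x : ℝ) : ℝ :=
  deriv (V t5 t2) x

noncomputable def PWc (U : ℝ → ℝ → ℝ → ℝ) (t5 t2 x : ℝ) : ℝ :=
  (1/12) * deriv^[2] (U t5 t2) x - (1/6) * t5 * U t5 t2 x + (7/18) * t5 ^ 2

section PartialDerivatives

open scoped ContDiff

variable {f : ℝ → ℝ → ℝ}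

lemma hasDerivAt_snd_of_contDiff (hf : ContDiff ℝ ∞ fun p : ℝ × ℝ => f p.1 p.2) (s x : ℝ) :
    HasDerivAt (f s) (fderiv ℝ (fun p : ℝ × ℝ => f p.1 p.2) (s, x) (0, 1)) x :=
  ((hf.differentiable (by simp)) (s, x)).hasFDerivAt.comp_hasDerivAt x
    ((hasDerivAt_const x s).prodMk (hasDerivAt_id' x))

lemma hasDerivAt_fst_of_contDiff (hf : ContDiff ℝ ∞ fun p : ℝ × ℝ => f p.1 p.2) (s x : ℝ) :
    HasDerivAt (fun r => f r x) (fderiv ℝ (fun p : ℝ × ℝ => f p.1 p.2) (s, x) (1, 0)) s :=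
  HasFDerivAt.comp_hasDerivAt (l := fun p : ℝ × ℝ => f p.1 p.2) s
    ((hf.differentiable (by simp)) (s, x)).hasFDerivAt
    ((hasDerivAt_id' s).prodMk (hasDerivAt_const s x))

lemma contDiff_deriv_snd (hf : ContDiff ℝ ∞ fun p : ℝ × ℝ => f p.1 p.2) :
    ContDiff ℝ ∞ fun p : ℝ × ℝ => deriv (f p.1) p.2 := by
  simp only [fun p : ℝ × ℝ => (hasDerivAt_snd_of_contDiff hf p.1 p.2).deriv]
  exact (hf.fderiv_right (by simp)).clm_apply contDiff_const

lemma contDiff_iterate_deriv_snd (hf : ContDiff ℝ ∞ fun p : ℝ × ℝ => f p.1 p.2) (n : ℕ) :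
    ContDiff ℝ ∞ fun p : ℝ × ℝ => deriv^[n] (f p.1) p.2 := by
  induction n with
  | zero => exact hf
  | succ n ih =>
    simp only [Function.iterate_succ_apply']
    exact contDiff_deriv_snd (f := fun s => deriv^[n] (f s)) ih

lemma deriv_fst_deriv_snd_comm (hf : ContDiff ℝ ∞ fun p : ℝ × ℝ => f p.1 p.2) (s x : ℝ) :
    deriv (fun r => deriv (f r) x) s = deriv (fun y => deriv (fun r => f r y) s) x := by
  set F : ℝ × ℝ → ℝ := fun p => f p.1 p.2
  have hd : Differentiable ℝ (fderiv ℝ F) :=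
    (hf.fderiv_right (m := ∞) (by simp)).differentiable (by simp)
  have h₁ : HasDerivAt (fun r => fderiv ℝ F (r, x))
      (fderiv ℝ (fderiv ℝ F) (s, x) (1, 0)) s :=
    (hd (s, x)).hasFDerivAt.comp_hasDerivAt s
      ((hasDerivAt_id' s).prodMk (hasDerivAt_const s x))
  have h₂ : HasDerivAt (fun y => fderiv ℝ F (s, y))
      (fderiv ℝ (fderiv ℝ F) (s, x) (0, 1)) x :=
    (hd (s, x)).hasFDerivAt.comp_hasDerivAt x
      ((hasDerivAt_const x s).prodMk (hasDerivAt_id' x))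
  have h₁' : HasDerivAt (fun r => fderiv ℝ F (r, x) (0, 1))
      (fderiv ℝ (fderiv ℝ F) (s, x) (1, 0) (0, 1)) s :=
    (ContinuousLinearMap.apply ℝ ℝ ((0, 1) : ℝ × ℝ)).hasFDerivAt.comp_hasDerivAt s h₁
  have h₂' : HasDerivAt (fun y => fderiv ℝ F (s, y) (1, 0))
      (fderiv ℝ (fderiv ℝ F) (s, x) (0, 1) (1, 0)) x :=
    (ContinuousLinearMap.apply ℝ ℝ ((1, 0) : ℝ × ℝ)).hasFDerivAt.comp_hasDerivAt x h₂
  simp only [fun r => (hasDerivAt_snd_of_contDiff hf r x).deriv,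
    fun y => (hasDerivAt_fst_of_contDiff hf s y).deriv]
  rw [h₁'.deriv, h₂'.deriv]
  refine hf.contDiffAt.isSymmSndFDerivAt ?_ _ _
  simpa using WithTop.coe_le_coe.2 (le_top : (2 : ℕ∞) ≤ ⊤)

lemma deriv_fst_iterate_deriv_snd_comm (hf : ContDiff ℝ ∞ fun p : ℝ × ℝ => f p.1 p.2) (n : ℕ)
    (s x : ℝ) :
    deriv (fun r => deriv^[n] (f r) x) s = deriv^[n] (fun y => deriv (fun r => f r y) s) x := by
  induction n generalizing x with
  | zero => rfl
  | succ n ih =>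
    simp only [Function.iterate_succ_apply']
    rw [deriv_fst_deriv_snd_comm (f := fun s => deriv^[n] (f s)) (contDiff_iterate_deriv_snd hf n)]
    exact congrArg (deriv · x) (funext ih)

lemma hasDerivAt_fst_iterate_deriv_snd (hf : ContDiff ℝ ∞ fun p : ℝ × ℝ => f p.1 p.2) (n : ℕ)
    (s x : ℝ) :
    HasDerivAt (fun r => deriv^[n] (f r) x)
      (deriv^[n] (fun y => deriv (fun r => f r y) s) x) s := by
  rw [← deriv_fst_iterate_deriv_snd_comm hf]
  exact (hasDerivAt_fst_of_contDiff (f := fun s => deriv^[n] (f s))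
    (contDiff_iterate_deriv_snd hf n) s x).differentiableAt.hasDerivAt

lemma hasDerivAt_iterate_deriv {g : ℝ → ℝ} (hg : ContDiff ℝ ∞ g) (n : ℕ) (x : ℝ) :
    HasDerivAt (deriv^[n] g) (deriv^[n + 1] g x) x := by
  rw [Function.iterate_succ_apply']
  exact ((hg.iterate_deriv n).differentiable (by simp) x).hasDerivAt

end PartialDerivatives

section HamiltonianGradient

lemma deriv_eq_of_forall_eq_cubic {p : ℝ → ℝ} (A B C D : ℝ)
    (hp : ∀ s, p s = A + B * s + C * s ^ 2 + D * s ^ 3) (a : ℝ) :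
    deriv p a = B + 2 * C * a + 3 * D * a ^ 2 := by
  rw [funext hp]
  have h := (((hasDerivAt_const a A).add ((hasDerivAt_id a).const_mul B)).add
    ((hasDerivAt_pow 2 a).const_mul C)).add ((hasDerivAt_pow 3 a).const_mul D)
  refine h.deriv.trans ?_
  push_cast
  ring

variable (qU qV qW pU pV pW t1 t2 t5 : ℝ)

lemma DpU_Ham2 :
    DpU Ham2 qU qV qW pU pV pW t1 t2 t5
      = -2 * pV := by
  refine (deriv_eq_of_forall_eq_cubic (Ham2 qU qV qW 0 pV pW t1 t2 t5)
    (-2 * pV)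
    0 0 (fun s => ?_) pU).trans ?_
  · simp only [Ham2]
    ring
  · ring

lemma DpV_Ham2 :
    DpV Ham2 qU qV qW pU pV pW t1 t2 t5
      = (1/2) * qU * qW - 2 * pU - (1/2) * t5 * qW := by
  refine (deriv_eq_of_forall_eq_cubic (Ham2 qU qV qW pU 0 pW t1 t2 t5)
    ((1/2) * qU * qW - 2 * pU - (1/2) * t5 * qW)
    0 0 (fun s => ?_) pV).trans ?_
  · simp only [Ham2]
    ring
  · ring

lemma DpW_Ham2 :
    DpW Ham2 qU qV qW pU pV pW t1 t2 t5
      = -6 * qU * qV + 4 * t2 + 2 * t5 * qV := by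
  refine (deriv_eq_of_forall_eq_cubic (Ham2 qU qV qW pU pV 0 t1 t2 t5)
    (-6 * qU * qV + 4 * t2 + 2 * t5 * qV)
    0 0 (fun s => ?_) pW).trans ?_
  · simp only [Ham2]
    ring
  · ring

lemma DqU_Ham2 :
    DqU Ham2 qU qV qW pU pV pW t1 t2 t5
      = (1/2) * pV * qW - 6 * pW * qV + 3 * qU ^ 2 * qV - 2 * t2 * qU + t5 * qV * qU
        - 2 * t5 * t2 := by
  refine (deriv_eq_of_forall_eq_cubic (Ham2 0 qV qW pU pV pW t1 t2 t5)
    ((1/2) * pV * qW - 6 * pW * qV - 2 * t5 * t2)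
    (-t2 + (1/2) * t5 * qV) qV (fun s => ?_) qU).trans ?_
  · simp only [Ham2]
    ring
  · ring

lemma DqV_Ham2 :
    DqV Ham2 qU qV qW pU pV pW t1 t2 t5
      = (1/4) * qW ^ 2 - 6 * pW * qU + 3 * qV ^ 2 + qU ^ 3 + 2 * t1 + (1/2) * t5 * (qU ^ 2 + 4 * pW)
        - (65/27) * t5 ^ 3 := by
  refine (deriv_eq_of_forall_eq_cubic (Ham2 qU 0 qW pU pV pW t1 t2 t5)
    ((1/4) * qW ^ 2 - 6 * pW * qU + qU ^ 3 + 2 * t1 + (1/2) * t5 * (qU ^ 2 + 4 * pW)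
        - (65/27) * t5 ^ 3)
    0 1 (fun s => ?_) qV).trans ?_
  · simp only [Ham2]
    ring
  · ring

lemma DqW_Ham2 :
    DqW Ham2 qU qV qW pU pV pW t1 t2 t5
      = (1/2) * pV * qU + (1/2) * qV * qW - (1/2) * t5 * pV := by
  refine (deriv_eq_of_forall_eq_cubic (Ham2 qU qV 0 pU pV pW t1 t2 t5)
    ((1/2) * pV * qU - (1/2) * t5 * pV)
    ((1/4) * qV) 0 (fun s => ?_) qW).trans ?_
  · simp only [Ham2]
    ring
  · ring

end HamiltonianGradient

theorem string_equation_hamiltonian_flow_t2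
    (U V : ℝ → ℝ → ℝ → ℝ)
    (hU : ContDiff ℝ (⊤ : ℕ∞) fun p : ℝ × ℝ × ℝ => U p.1 p.2.1 p.2.2)
    (hV : ContDiff ℝ (⊤ : ℕ∞) fun p : ℝ × ℝ × ℝ => V p.1 p.2.1 p.2.2)
    (hS1 : ∀ t5 t2 x : ℝ,
      0 = (1/2) * deriv^[2] (V t5 t2) x - (3/2) * U t5 t2 x * V t5 t2 x
        + (5/2) * t5 * V t5 t2 x + t2)
    (hS2 : ∀ t5 t2 x : ℝ,
      0 = (1/12) * deriv^[4] (U t5 t2) x - (3/4) * deriv^[2] (U t5 t2) x * U t5 t2 x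
        - (3/8) * (deriv (U t5 t2) x) ^ 2 + (3/2) * (V t5 t2 x) ^ 2 + (1/2) * (U t5 t2 x) ^ 3
        - (5/12) * t5 * (3 * (U t5 t2 x) ^ 2 - deriv^[2] (U t5 t2) x) + x)
    (hF1 : ∀ t5 t2 x : ℝ, deriv (fun s => U t5 s x) t2 = -2 * deriv (V t5 t2) x)
    (hF2 : ∀ t5 t2 x : ℝ,
      deriv (fun s => V t5 s x) t2 = (1/6) * deriv^[3] (U t5 t2) x - U t5 t2 x * deriv (U t5 t2) x)
    (hF3 : ∀ t5 t2 x : ℝ,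
      deriv (fun s => U s t2 x) t5
        = deriv (fun y => -(1/6) * U t5 t2 y * deriv^[2] (U t5 t2) y
            + (1/8) * (deriv (U t5 t2) y) ^ 2 + (1/4) * (U t5 t2 y) ^ 3
            - (1/2) * (V t5 t2 y) ^ 2
            - (5/9) * t5 * (3 * (U t5 t2 y) ^ 2 - deriv^[2] (U t5 t2) y) + (4/3) * y) x)
    (hF4 : ∀ t5 t2 x : ℝ,
      deriv (fun s => V s t2 x) t5
        = deriv (fun y => (1/12) * deriv^[2] (U t5 t2) y * V t5 t2 y
            - (1/4) * deriv (U t5 t2) y * deriv (V t5 t2) y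
            + (5/16) * (U t5 t2 y) ^ 2 * V t5 t2 y
            - ((5/3) * t5 + (1/4) * U t5 t2 y) ^ 2 * V t5 t2 y - t2 * U t5 t2 y) x) :
    ∀ t5 t2 x : ℝ,
      deriv (fun s => QUc U t5 s x) t2
        = DpU Ham2 (QUc U t5 t2 x) (QVc V t5 t2 x) (QWc U t5 t2 x) (PUc U t5 t2 x) (PVc V t5 t2 x) (PWc U t5 t2 x) x t2 t5
      ∧ deriv (fun s => QVc V t5 s x) t2
        = DpV Ham2 (QUc U t5 t2 x) (QVc V t5 t2 x) (QWc U t5 t2 x) (PUc U t5 t2 x) (PVc V t5 t2 x) (PWc U t5 t2 x) x t2 t5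
      ∧ deriv (fun s => QWc U t5 s x) t2
        = DpW Ham2 (QUc U t5 t2 x) (QVc V t5 t2 x) (QWc U t5 t2 x) (PUc U t5 t2 x) (PVc V t5 t2 x) (PWc U t5 t2 x) x t2 t5
      ∧ deriv (fun s => PUc U t5 s x) t2
        = - (DqU Ham2 (QUc U t5 t2 x) (QVc V t5 t2 x) (QWc U t5 t2 x) (PUc U t5 t2 x) (PVc V t5 t2 x) (PWc U t5 t2 x) x t2 t5)
      ∧ deriv (fun s => PVc V t5 s x) t2
        = - (DqV Ham2 (QUc U t5 t2 x) (QVc V t5 t2 x) (QWc U t5 t2 x) (PUc U t5 t2 x) (PVc V t5 t2 x) (PWc U t5 t2 x) x t2 t5)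
      ∧ deriv (fun s => PWc U t5 s x) t2
        = - (DqW Ham2 (QUc U t5 t2 x) (QVc V t5 t2 x) (QWc U t5 t2 x) (PUc U t5 t2 x) (PVc V t5 t2 x) (PWc U t5 t2 x) x t2 t5) := by
  intro t5 t2 x
  have hUs : ContDiff ℝ (⊤ : ℕ∞) fun p : ℝ × ℝ => U t5 p.1 p.2 :=
    hU.comp (contDiff_const.prodMk contDiff_id)
  have hVs : ContDiff ℝ (⊤ : ℕ∞) fun p : ℝ × ℝ => V t5 p.1 p.2 :=
    hV.comp (contDiff_const.prodMk contDiff_id)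
  have hUx : ContDiff ℝ (⊤ : ℕ∞) (U t5 t2) := hUs.comp (contDiff_const.prodMk contDiff_id)
  have hVx : ContDiff ℝ (⊤ : ℕ∞) (V t5 t2) := hVs.comp (contDiff_const.prodMk contDiff_id)
  have dU := hasDerivAt_iterate_deriv hUx
  have dV := hasDerivAt_iterate_deriv hVx
  -- The first string equation expresses the higher `x`-derivatives of `V` by lower ones.
  have hV2 : deriv^[2] (V t5 t2)
      = fun y => 3 * (U t5 t2 y * V t5 t2 y) - 5 * t5 * V t5 t2 y - 2 * t2 := by
    funext y
    linear_combination -2 * hS1 t5 t2 y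
  have hV3 : deriv^[3] (V t5 t2)
      = fun y => 3 * (deriv (U t5 t2) y * V t5 t2 y + U t5 t2 y * deriv (V t5 t2) y)
          - 5 * t5 * deriv (V t5 t2) y := by
    funext y
    rw [Function.iterate_succ_apply', hV2]
    exact ((((dU 0 y).mul (dV 0 y)).const_mul 3).sub ((dV 0 y).const_mul (5 * t5))
      |>.sub_const (2 * t2)).deriv
  have hV4 : deriv^[4] (V t5 t2) x
      = 3 * ((deriv^[2] (U t5 t2) x * V t5 t2 x + deriv (U t5 t2) x * deriv (V t5 t2) x)
          + (deriv (U t5 t2) x * deriv (V t5 t2) x + U t5 t2 x * deriv^[2] (V t5 t2) x))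
          - 5 * t5 * deriv^[2] (V t5 t2) x := by
    rw [Function.iterate_succ_apply', hV3]
    exact (((((dU 1 x).mul (dV 0 x)).add ((dU 0 x).mul (dV 1 x))).const_mul 3).sub
      ((dV 1 x).const_mul (5 * t5))).deriv
  have hFU (n : ℕ) (y : ℝ) : deriv^[n] (fun z => deriv (fun s => U t5 s z) t2) y
      = -2 * deriv^[n + 1] (V t5 t2) y := by
    induction n generalizing y with
    | zero => exact hF1 t5 t2 y
    | succ n ih =>
      rw [Function.iterate_succ_apply', funext ih]
      exact ((dV (n + 1) y).const_mul (-2)).deriv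
  have hFV : deriv^[1] (fun z => deriv (fun s => V t5 s z) t2) x
      = (1/6) * deriv^[4] (U t5 t2) x
        - (deriv (U t5 t2) x * deriv (U t5 t2) x + U t5 t2 x * deriv^[2] (U t5 t2) x) := by
    simp only [hF2]
    exact (((dU 3 x).const_mul (1/6)).sub ((dU 0 x).mul (dU 1 x))).deriv
  have eU (n : ℕ) : HasDerivAt (fun s => deriv^[n] (U t5 s) x)
      (-2 * deriv^[n + 1] (V t5 t2) x) t2 :=
    hFU n x ▸ hasDerivAt_fst_iterate_deriv_snd hUs n t2 x
  have eV := (hasDerivAt_fst_iterate_deriv_snd hVs 1 t2 x).deriv.trans hFV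
  have hV2x := congrFun hV2 x
  have hV3x := congrFun hV3 x
  rw [DpU_Ham2, DpV_Ham2, DpW_Ham2, DqU_Ham2, DqV_Ham2, DqW_Ham2]
  simp only [QUc, QVc, QWc, PUc, PVc, PWc]
  refine ⟨?_, ?_, ?_, ?_, ?_, ?_⟩
  · exact ((eU 0).sub_const _).deriv
  · linear_combination hF2 t5 t2 x
  · refine (eU 1).deriv.trans ?_
    linear_combination -2 * hV2x
  · refine (((((eU 0).const_mul 3).mul (eU 1)).sub ((eU 3).const_mul (1/3))).sub
      ((eU 1).const_mul ((7/3) * t5)) |>.const_mul (1/4)).deriv.trans ?_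
    simp only [zero_add, Nat.reduceAdd, Function.iterate_zero, Function.iterate_one, id_eq, hV4,
      hV2x]
    ring
  · refine eV.trans ?_
    linear_combination -2 * hS2 t5 t2 x
  · refine ((((eU 2).const_mul (1/12)).sub ((eU 0).const_mul ((1/6) * t5))).add_const _).deriv.trans
      ?_
    simp only [zero_add, Nat.reduceAdd, Function.iterate_one, hV3x]
    ring
end

section
/- Fix t₅, t₂ ∈ ℝ and let Q_U, Q_V, Q_W, P_U, P_V, P_W : ℝ → ℝ be smooth functions of x satisfying Hamilton's equations for H₁ with t₁ = x: dQ_a/dx = ∂H₁/∂P_a and dP_a/dx = −∂H₁/∂Q_a for a ∈ {U,V,W}, the partial derivatives of H₁ being evaluated at (Q_U(x),Q_V(x),Q_W(x),P_U(x),P_V(x),P_W(x),x,t₂,t₅). Define U(x) := Q_U(x) + (4/3)t₅ and V(x) := Q_V(x). Then: Q_W = U', P_V = V', P_W = (1/12)U'' − (1/6)t₅·U + (7/18)t₅², and U, V satisfy the (3,4) string equation: V'' = 3U·V − 5t₅·V − 2t₂ and 0 = (1/12)U'''' − (3/4)U''·U − (3/8)(U')² + (3/2)V² + (1/2)U³ −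 (5/12)t₅·(3U² − U'') + x. -/
noncomputable def Ham1 {K : Type*} [Field K] (qU qV qW pU pV pW t1 t2 t5 : K) : K :=
  pU * qW + 6 * pW ^ 2 - (3/8) * qU * qW ^ 2 + (1/2) * pV ^ 2 - (1/8) * qU ^ 4
    - (3/2) * qU * qV ^ 2 - t1 * qU + 2 * t2 * qV
    + (1/8) * t5 * (16 * qU * pW - 2 * qU ^ 3 + 4 * qV ^ 2 - qW ^ 2)
    - (1/2) * t5 ^ 2 * (4 * pW - qU ^ 2)
    + (19/27) * t5 ^ 3 * qU + (41/54) * t5 ^ 4 - (4/3) * t5 * t1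

/-- A function equal pointwise to a quadratic polynomial has the expected derivative. -/
theorem deriv_eq_of_eq_quadratic {f : ℝ → ℝ} (a b c : ℝ) (hf : ∀ s, f s = a * s ^ 2 + b * s + c)
    (s : ℝ) : deriv f s = 2 * a * s + b := by
  have h := ((((hasDerivAt_id s).pow 2).const_mul a).add
    ((hasDerivAt_id s).const_mul b)).add_const c
  have hfe : f = fun s => a * s ^ 2 + b * s + c := funext hf
  rw [hfe]
  refine HasDerivAt.deriv (h.congr_deriv ?_)
  simp
  ring

section HamPartials

variable (qU qV qW pU pV pW t1 t2 t5 : ℝ)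

theorem DpU_Ham1 : DpU Ham1 qU qV qW pU pV pW t1 t2 t5 = qW := by
  unfold DpU
  rw [deriv_eq_of_eq_quadratic 0 qW (Ham1 qU qV qW 0 pV pW t1 t2 t5)
    (fun s => by unfold Ham1; ring)]
  ring

theorem DpV_Ham1 : DpV Ham1 qU qV qW pU pV pW t1 t2 t5 = pV := by
  unfold DpV
  rw [deriv_eq_of_eq_quadratic (1/2) 0 (Ham1 qU qV qW pU 0 pW t1 t2 t5)
    (fun s => by unfold Ham1; ring)]
  ring

theorem DpW_Ham1 :
    DpW Ham1 qU qV qW pU pV pW t1 t2 t5 = 12 * pW + 2 * t5 * qU - 2 * t5 ^ 2 := by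
  unfold DpW
  rw [deriv_eq_of_eq_quadratic 6 (2 * t5 * qU - 2 * t5 ^ 2) (Ham1 qU qV qW pU pV 0 t1 t2 t5)
    (fun s => by unfold Ham1; ring)]
  ring

theorem DqV_Ham1 :
    DqV Ham1 qU qV qW pU pV pW t1 t2 t5 = -3 * qU * qV + 2 * t2 + t5 * qV := by
  unfold DqV
  rw [deriv_eq_of_eq_quadratic (-(3/2) * qU + t5 / 2) (2 * t2) (Ham1 qU 0 qW pU pV pW t1 t2 t5)
    (fun s => by unfold Ham1; ring)]
  ring

theorem DqW_Ham1 :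
    DqW Ham1 qU qV qW pU pV pW t1 t2 t5 = pU - 3/4 * qU * qW - 1/4 * t5 * qW := by
  unfold DqW
  rw [deriv_eq_of_eq_quadratic (-(3/8) * qU - t5 / 8) pU (Ham1 qU qV 0 pU pV pW t1 t2 t5)
    (fun s => by unfold Ham1; ring)]
  ring

theorem DqU_Ham1 :
    DqU Ham1 qU qV qW pU pV pW t1 t2 t5 =
      -(3/8) * qW ^ 2 - 1/2 * qU ^ 3 - 3/2 * qV ^ 2 - t1 + 2 * t5 * pW - 3/4 * t5 * qU ^ 2
        + t5 ^ 2 * qU + 19/27 * t5 ^ 3 := by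
  have hHam : (fun s => Ham1 s qV qW pU pV pW t1 t2 t5) = fun s =>
      -(1/8) * s ^ 4 + -(1/4) * t5 * s ^ 3 + 1/2 * t5 ^ 2 * s ^ 2
        + (-(3/8) * qW ^ 2 - 3/2 * qV ^ 2 - t1 + 2 * t5 * pW + 19/27 * t5 ^ 3) * s
        + Ham1 0 qV qW pU pV pW t1 t2 t5 := by
    funext s
    unfold Ham1
    ring
  have h := ((((((hasDerivAt_id qU).pow 4).const_mul (-(1/8))).add
    (((hasDerivAt_id qU).pow 3).const_mul (-(1/4) * t5))).add
    (((hasDerivAt_id qU).pow 2).const_mul (1/2 * t5 ^ 2))).add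
    ((hasDerivAt_id qU).const_mul
      (-(3/8) * qW ^ 2 - 3/2 * qV ^ 2 - t1 + 2 * t5 * pW + 19/27 * t5 ^ 3))).add_const
    (Ham1 0 qV qW pU pV pW t1 t2 t5)
  unfold DqU
  rw [hHam]
  refine HasDerivAt.deriv (h.congr_deriv ?_)
  simp
  ring

end HamPartials

theorem hamilton_implies_string_equation (t5 t2 : ℝ)
    (QU QV QW PU PV PW : ℝ → ℝ)
    (hQUs : ContDiff ℝ (⊤ : ℕ∞) QU) (hQVs : ContDiff ℝ (⊤ : ℕ∞) QV)
    (hQWs : ContDiff ℝ (⊤ : ℕ∞) QW) (hPUs : ContDiff ℝ (⊤ : ℕ∞) PU)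
    (hPVs : ContDiff ℝ (⊤ : ℕ∞) PV) (hPWs : ContDiff ℝ (⊤ : ℕ∞) PW)
    (hQU : ∀ x : ℝ, deriv QU x = DpU Ham1 (QU x) (QV x) (QW x) (PU x) (PV x) (PW x) x t2 t5)
    (hQV : ∀ x : ℝ, deriv QV x = DpV Ham1 (QU x) (QV x) (QW x) (PU x) (PV x) (PW x) x t2 t5)
    (hQW : ∀ x : ℝ, deriv QW x = DpW Ham1 (QU x) (QV x) (QW x) (PU x) (PV x) (PW x) x t2 t5)
    (hPU : ∀ x : ℝ, deriv PU x = - DqU Ham1 (QU x) (QV x) (QW x) (PU x) (PV x) (PW x) x t2 t5)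
    (hPV : ∀ x : ℝ, deriv PV x = - DqV Ham1 (QU x) (QV x) (QW x) (PU x) (PV x) (PW x) x t2 t5)
    (hPW : ∀ x : ℝ, deriv PW x = - DqW Ham1 (QU x) (QV x) (QW x) (PU x) (PV x) (PW x) x t2 t5) :
    ∀ x : ℝ,
      QW x = deriv (fun y => QU y + (4/3) * t5) x
      ∧ PV x = deriv QV x
      ∧ PW x = (1/12) * deriv^[2] (fun y => QU y + (4/3) * t5) x - (1/6) * t5 * (QU x + (4/3) * t5) + (7/18) * t5 ^ 2
      ∧ deriv^[2] QV x = 3 * (QU x + (4/3) * t5) * QV x - 5 * t5 * QV x - 2 * t2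
      ∧ 0 = (1/12) * deriv^[4] (fun y => QU y + (4/3) * t5) x
          - (3/4) * deriv^[2] (fun y => QU y + (4/3) * t5) x * (QU x + (4/3) * t5)
          - (3/8) * (deriv (fun y => QU y + (4/3) * t5) x) ^ 2 + (3/2) * (QV x) ^ 2
          + (1/2) * (QU x + (4/3) * t5) ^ 3
          - (5/12) * t5 * (3 * (QU x + (4/3) * t5) ^ 2 - deriv^[2] (fun y => QU y + (4/3) * t5) x) + x := by
  simp only [DpU_Ham1] at hQU
  simp only [DpV_Ham1] at hQV
  simp only [DpW_Ham1] at hQW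
  simp only [DqU_Ham1] at hPU
  simp only [DqV_Ham1] at hPV
  simp only [DqW_Ham1] at hPW
  have hasDeriv {f : ℝ → ℝ} (hf : ContDiff ℝ (⊤ : ℕ∞) f) (x : ℝ) : HasDerivAt f (deriv f x) x :=
    (hf.differentiable (by simp) x).hasDerivAt
  have hU1 : deriv (fun y => QU y + (4/3) * t5) = QW := by
    funext x
    rw [deriv_add_const, hQU]
  have hU2 : deriv^[2] (fun y => QU y + (4/3) * t5)
      = fun x => 12 * PW x + 2 * t5 * QU x - 2 * t5 ^ 2 := by
    funext x
    simp only [Function.iterate_succ, Function.iterate_zero, Function.comp, id, hU1, hQW]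
  have hU3 : deriv^[3] (fun y => QU y + (4/3) * t5)
      = fun x => -12 * PU x + 9 * (QU x * QW x) + 5 * t5 * QW x := by
    funext x
    rw [Function.iterate_succ_apply', hU2]
    refine HasDerivAt.deriv (((((hasDeriv hPWs x).const_mul 12).add
      ((hasDeriv hQUs x).const_mul (2 * t5))).sub_const (2 * t5 ^ 2)).congr_deriv ?_)
    rw [hPW, hQU]
    ring
  have hU4 (x : ℝ) : deriv^[4] (fun y => QU y + (4/3) * t5) x
      = -12 * deriv PU x + 9 * (QW x * QW x + QU x * deriv QW x) + 5 * t5 * deriv QW x := by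
    rw [Function.iterate_succ_apply', hU3]
    refine HasDerivAt.deriv (((((hasDeriv hPUs x).const_mul (-12)).add
      (((hasDeriv hQUs x).mul (hasDeriv hQWs x)).const_mul 9)).add
      ((hasDeriv hQWs x).const_mul (5 * t5))).congr_deriv ?_)
    rw [hQU]
  have hV1 : deriv QV = PV := funext hQV
  have hV2 (x : ℝ) : deriv^[2] QV x = deriv PV x := by
    rw [Function.iterate_succ_apply', Function.iterate_one, hV1]
  intro x
  refine ⟨by rw [hU1], (hQV x).symm, ?_, ?_, ?_⟩
  · rw [hU2]
    ring
  · rw [hV2, hPV]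
    ring
  · rw [hU4, hU2, hU1, hPU, hQW]
    ring
end

section
/- Let K ⊂ ℂ³ be compact and ε > 0. Then there exists M > 0 such that for all (t₅, t₂, x) ∈ K, all ℓ ∈ ℤ, all r > M and all θ ∈ ℝ, with ξ := r·e^{iθ}: (a) if (π/21)(6ℓ + 2) + ε < θ < (π/21)(6ℓ + 5) − ε then Re ϑ₁(ξ) < Re ϑ₂(ξ); (b) if (π/21)(6ℓ) + ε < θ < (π/21)(6ℓ + 3) − ε then Re ϑ₂(ξ) < Re ϑ₃(ξ); (c) if (π/21)(6ℓ + 1) + ε < θ < (π/21)(6ℓ + 4) − ε then Re ϑ₁(ξ) < Re ϑ₃(ξ). -/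
noncomputable def omg : ℂ := Complex.exp (2 * Real.pi * Complex.I / 3)

noncomputable def vtheta (j : ℤ) (t5 t2 x ξ : ℂ) : ℂ :=
  (3/7) * omg ^ (j - 1) * ξ ^ 7 + omg ^ (1 - j) * t5 * ξ ^ 5
    + omg ^ (1 - j) * t2 * ξ ^ 2 + omg ^ (j - 1) * x * ξ

theorem omg_eq : omg = ⟨-1 / 2, √3 / 2⟩ := by
  have h : (2 * Real.pi * Complex.I / 3 : ℂ) = ((Real.pi - Real.pi / 3 : ℝ) : ℂ) * Complex.I := by
    push_cast
    ring
  rw [omg, h]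
  apply Complex.ext
  · rw [Complex.exp_ofReal_mul_I_re, Real.cos_pi_sub, Real.cos_pi_div_three]
    norm_num
  · rw [Complex.exp_ofReal_mul_I_im, Real.sin_pi_sub, Real.sin_pi_div_three]

theorem omg_sq : omg ^ 2 = ⟨-1 / 2, -(√3 / 2)⟩ := by
  have h3 : √3 * √3 = 3 := Real.mul_self_sqrt (by norm_num)
  rw [omg_eq, sq]
  apply Complex.ext
  · simp only [Complex.mul_re]
    linarith
  · simp only [Complex.mul_im]
    ring

theorem norm_omg : ‖omg‖ = 1 := by
  have h : (2 * Real.pi * Complex.I / 3 : ℂ) = ((2 * Real.pi / 3 : ℝ) : ℂ) * Complex.I := by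
    push_cast
    ring
  rw [omg, h, Complex.norm_exp_ofReal_mul_I]

theorem norm_omg_zpow_sub_le (m n : ℤ) : ‖omg ^ m - omg ^ n‖ ≤ 2 := by
  refine (norm_sub_le _ _).trans ?_
  rw [norm_zpow, norm_zpow, norm_omg, one_zpow, one_zpow]
  norm_num

/-- On the arcs at distance more than `δ` from the zeros bounding them, a positive sine is
uniformly bounded away from zero. -/
theorem exists_pos_le_sin_of_mem_arc {δ : ℝ} (hδ : 0 < δ) :
    ∃ s : ℝ, 0 < s ∧ ∀ (n : ℤ) (y : ℝ), n * (2 * Real.pi) + δ < y →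
      y < n * (2 * Real.pi) + Real.pi - δ → s ≤ Real.sin y := by
  by_cases h : δ < Real.pi / 2
  · refine ⟨Real.sin δ, Real.sin_pos_of_pos_of_lt_pi hδ (by linarith), fun n y h₁ h₂ => ?_⟩
    rw [← Real.sin_sub_int_mul_two_pi y n]
    rcases le_total (y - n * (2 * Real.pi)) (Real.pi / 2) with hy | hy
    · exact Real.sin_le_sin_of_le_of_le_pi_div_two (by linarith) hy (by linarith)
    · rw [← Real.sin_pi_sub (y - n * (2 * Real.pi))]
      exact Real.sin_le_sin_of_le_of_le_pi_div_two (by linarith) (by linarith) (by linarith)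
  · exact ⟨1, one_pos, fun n y h₁ h₂ => by linarith⟩

/-- If the coefficient of `ξ ^ 7` has real part at most `-c` in the direction `θ`, the degree seven
term dominates for large `r`. -/
theorem re_degree_seven_neg {a b t5 t2 x : ℂ} {B c r θ : ℝ} (ha : ‖a‖ ≤ 2) (hb : ‖b‖ ≤ 2)
    (h5 : ‖t5‖ ≤ B) (h2 : ‖t2‖ ≤ B) (hx : ‖x‖ ≤ B) (hr : 1 ≤ r) (hc : 14 * B < c * r)
    (h : (a * Complex.exp (((7 * θ : ℝ) : ℂ) * Complex.I)).re ≤ -c) :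
    ((3 / 7) * a * ((r : ℂ) * Complex.exp ((θ : ℂ) * Complex.I)) ^ 7
      + b * t5 * ((r : ℂ) * Complex.exp ((θ : ℂ) * Complex.I)) ^ 5
      + b * t2 * ((r : ℂ) * Complex.exp ((θ : ℂ) * Complex.I)) ^ 2
      + a * x * ((r : ℂ) * Complex.exp ((θ : ℂ) * Complex.I))).re < 0 := by
  have hB : 0 ≤ B := (norm_nonneg x).trans hx
  have hr0 : 0 ≤ r := by linarith
  have lead : (3 / 7) * a * ((r : ℂ) * Complex.exp ((θ : ℂ) * Complex.I)) ^ 7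
      = ((3 / 7 * r ^ 7 : ℝ) : ℂ) * (a * Complex.exp (((7 * θ : ℝ) : ℂ) * Complex.I)) := by
    have : (((7 * θ : ℝ) : ℂ) * Complex.I) = (7 : ℕ) * ((θ : ℂ) * Complex.I) := by
      push_cast
      ring
    rw [this, Complex.exp_nat_mul]
    push_cast
    ring
  have lower : ∀ (u v : ℂ) (k : ℕ), k ≤ 6 → ‖u‖ ≤ 2 → ‖v‖ ≤ B →
      (u * v * ((r : ℂ) * Complex.exp ((θ : ℂ) * Complex.I)) ^ k).re ≤ 2 * B * r ^ 6 := by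
    intro u v k hk hu hv
    refine (Complex.re_le_norm _).trans ?_
    rw [norm_mul, norm_mul, norm_pow, norm_mul, Complex.norm_exp_ofReal_mul_I, mul_one,
      Complex.norm_real, Real.norm_of_nonneg hr0]
    gcongr
  have e5 := lower b t5 5 (by norm_num) hb h5
  have e2 := lower b t2 2 (by norm_num) hb h2
  have e1 := lower a x 1 (by norm_num) ha hx
  rw [pow_one] at e1
  have e7 : 3 / 7 * r ^ 7 * (a * Complex.exp (((7 * θ : ℝ) : ℂ) * Complex.I)).re
      ≤ 3 / 7 * r ^ 7 * -c := by gcongr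
  have hdom : 14 * B * r ^ 6 < c * r * r ^ 6 := by gcongr
  rw [Complex.add_re, Complex.add_re, Complex.add_re, lead, Complex.re_ofReal_mul]
  nlinarith

theorem vtheta_re_lt {j k : ℤ} {t5 t2 x : ℂ} {B c r θ : ℝ}
    (h5 : ‖t5‖ ≤ B) (h2 : ‖t2‖ ≤ B) (hx : ‖x‖ ≤ B) (hr : 1 ≤ r) (hc : 14 * B < c * r)
    (h : ((omg ^ (j - 1) - omg ^ (k - 1)) *
      Complex.exp (((7 * θ : ℝ) : ℂ) * Complex.I)).re ≤ -c) :
    (vtheta j t5 t2 x ((r : ℂ) * Complex.exp ((θ : ℂ) * Complex.I))).re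
      < (vtheta k t5 t2 x ((r : ℂ) * Complex.exp ((θ : ℂ) * Complex.I))).re := by
  rw [← sub_neg, ← Complex.sub_re]
  convert re_degree_seven_neg (norm_omg_zpow_sub_le _ _)
    (norm_omg_zpow_sub_le (1 - j) (1 - k)) h5 h2 hx hr hc h using 2
  unfold vtheta
  ring

theorem re_one_sub_omg_mul_exp (ψ : ℝ) :
    ((1 - omg) * Complex.exp ((ψ : ℂ) * Complex.I)).re
      = -(√3 * Real.sin (ψ - 2 * Real.pi / 3)) := by
  have h3 : √3 * √3 = 3 := Real.mul_self_sqrt (by norm_num)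
  have e : ψ - 2 * Real.pi / 3 = ψ + Real.pi / 3 - Real.pi := by ring
  rw [e, Real.sin_sub_pi, Real.sin_add, Real.cos_pi_div_three, Real.sin_pi_div_three,
    Complex.mul_re, Complex.exp_ofReal_mul_I_re, Complex.exp_ofReal_mul_I_im, omg_eq]
  simp only [Complex.sub_re, Complex.sub_im, Complex.one_re, Complex.one_im]
  linear_combination (-(Real.cos ψ) / 2) * h3

theorem re_omg_sub_omg_sq_mul_exp (ψ : ℝ) :
    ((omg - omg ^ 2) * Complex.exp ((ψ : ℂ) * Complex.I)).re = -(√3 * Real.sin ψ) := by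
  rw [Complex.mul_re, Complex.exp_ofReal_mul_I_re, Complex.exp_ofReal_mul_I_im, omg_sq, omg_eq]
  simp only [Complex.sub_re, Complex.sub_im]
  ring

theorem re_one_sub_omg_sq_mul_exp (ψ : ℝ) :
    ((1 - omg ^ 2) * Complex.exp ((ψ : ℂ) * Complex.I)).re
      = -(√3 * Real.sin (ψ - Real.pi / 3)) := by
  have h3 : √3 * √3 = 3 := Real.mul_self_sqrt (by norm_num)
  rw [Real.sin_sub, Real.cos_pi_div_three, Real.sin_pi_div_three,
    Complex.mul_re, Complex.exp_ofReal_mul_I_re, Complex.exp_ofReal_mul_I_im, omg_sq]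
  simp only [Complex.sub_re, Complex.sub_im, Complex.one_re, Complex.one_im]
  linear_combination (-(Real.cos ψ) / 2) * h3

theorem sector_ordering_of_exponents (K : Set (ℂ × ℂ × ℂ)) (hK : IsCompact K)
    (ε : ℝ) (hε : 0 < ε) :
    ∃ M : ℝ, 0 < M ∧ ∀ t5 t2 x : ℂ, (t5, t2, x) ∈ K → ∀ ℓ : ℤ, ∀ r : ℝ, M < r → ∀ θ : ℝ,
      ((Real.pi / 21 * (6 * (ℓ : ℝ) + 2) + ε < θ ∧ θ < Real.pi / 21 * (6 * (ℓ : ℝ) + 5) - ε) →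
        (vtheta 1 t5 t2 x ((r : ℂ) * Complex.exp ((θ : ℂ) * Complex.I))).re < (vtheta 2 t5 t2 x ((r : ℂ) * Complex.exp ((θ : ℂ) * Complex.I))).re)
      ∧ ((Real.pi / 21 * (6 * (ℓ : ℝ) + 0) + ε < θ ∧ θ < Real.pi / 21 * (6 * (ℓ : ℝ) + 3) - ε) →
        (vtheta 2 t5 t2 x ((r : ℂ) * Complex.exp ((θ : ℂ) * Complex.I))).re < (vtheta 3 t5 t2 x ((r : ℂ) * Complex.exp ((θ : ℂ) * Complex.I))).re)
      ∧ ((Real.pi / 21 * (6 * (ℓ : ℝ) + 1) + ε < θ ∧ θ < Real.pi / 21 * (6 * (ℓ : ℝ) + 4) - ε) →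
        (vtheta 1 t5 t2 x ((r : ℂ) * Complex.exp ((θ : ℂ) * Complex.I))).re < (vtheta 3 t5 t2 x ((r : ℂ) * Complex.exp ((θ : ℂ) * Complex.I))).re) := by
  obtain ⟨s, hs, hsin⟩ := exists_pos_le_sin_of_mem_arc (δ := 7 * ε) (by positivity)
  obtain ⟨B, hB⟩ := hK.isBounded.exists_norm_le
  have hc : 0 < √3 * s := by positivity
  refine ⟨max 1 (14 * B / (√3 * s)), by positivity, fun t5 t2 x hmem ℓ r hr θ => ?_⟩
  obtain ⟨h5, h2x⟩ := norm_prod_le_iff.mp (hB _ hmem)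
  obtain ⟨h2, hx⟩ := norm_prod_le_iff.mp h2x
  have hr1 : 1 ≤ r := (le_max_left _ _).trans hr.le
  have hrc : 14 * B < √3 * s * r := by
    rw [mul_comm (√3 * s)]
    exact (div_lt_iff₀ hc).mp ((le_max_right _ _).trans_lt hr)
  refine ⟨fun h => vtheta_re_lt h5 h2 hx hr1 hrc ?_, fun h => vtheta_re_lt h5 h2 hx hr1 hrc ?_,
    fun h => vtheta_re_lt h5 h2 hx hr1 hrc ?_⟩
  · have := hsin ℓ (7 * θ - 2 * Real.pi / 3) (by linarith [h.1]) (by linarith [h.2])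
    have e : omg ^ ((1 : ℤ) - 1) - omg ^ ((2 : ℤ) - 1) = 1 - omg := by norm_num
    rw [e, re_one_sub_omg_mul_exp]
    gcongr
  · have := hsin ℓ (7 * θ) (by linarith [h.1]) (by linarith [h.2])
    have e : omg ^ ((2 : ℤ) - 1) - omg ^ ((3 : ℤ) - 1) = omg - omg ^ 2 := by norm_num
    rw [e, re_omg_sub_omg_sq_mul_exp]
    gcongr
  · have := hsin ℓ (7 * θ - Real.pi / 3) (by linarith [h.1]) (by linarith [h.2])
    have e : omg ^ ((1 : ℤ) - 1) - omg ^ ((3 : ℤ) - 1) = 1 - omg ^ 2 := by norm_num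
    rw [e, re_one_sub_omg_sq_mul_exp]
    gcongr
end
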